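/- Let M_V be a symmetric N×N real matrix and M_E an M×M real matrix (both constant in time), and let 𝟙 ∈ ℝ^M be the vector of all ones. Let v : ℝ → ℝ^N and e : ℝ → ℝ^M be differentiable on an interval I, and suppose that for every t ∈ I their derivatives satisfy M_V v′(t) = −F(t) 𝟙 and M_E e′(t) = F(t)ᵀ v(t), where F(t) is an N×M real matrix for each t. Then the discrete total energy ½ v(t)ᵀ M_V v(t) + 𝟙ᵀ M_E e(t) is constant on I. -/

import Mathlib

open Matrix

theorem HasDerivWithinAt.dotProduct {n : Type*} [Fintype n] {f g : ℝ → n → ℝ} {f' g' : n → ℝ}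
    {s : Set ℝ} {t : ℝ} (hf : HasDerivWithinAt f f' s t) (hg : HasDerivWithinAt g g' s t) :
    HasDerivWithinAt (fun x => f x ⬝ᵥ g x) (f' ⬝ᵥ g t + f t ⬝ᵥ g') s t := by
  rw [hasDerivWithinAt_pi] at hf hg
  simp only [_root_.dotProduct, ← Finset.sum_add_distrib]
  exact HasDerivWithinAt.fun_sum fun i _ => (hf i).mul (hg i)

theorem HasDerivWithinAt.const_mulVec {m n : Type*} [Fintype m] [Fintype n] (A : Matrix m n ℝ)
    {f : ℝ → n → ℝ} {f' : n → ℝ} {s : Set ℝ} {t : ℝ} (hf : HasDerivWithinAt f f' s t) :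
    HasDerivWithinAt (fun x => A *ᵥ f x) (A *ᵥ f') s t :=
  (LinearMap.toContinuousLinearMap A.mulVecLin).hasFDerivAt.comp_hasDerivWithinAt t hf

/-- If on an interval `I` the semi-discrete equations `M_V v′(t) = −F(t) 𝟙` and
`M_E e′(t) = F(t)ᵀ v(t)` hold, then the discrete total energy
`½ v(t)ᵀ M_V v(t) + 𝟙ᵀ M_E e(t)` is constant on `I`. -/
theorem semidiscrete_total_energy_constant
    (N M : ℕ) (hN : 0 < N) (hM : 0 < M)
    (MV : Matrix (Fin N) (Fin N) ℝ) (hMVsymm : MVᵀ = MV)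
    (ME : Matrix (Fin M) (Fin M) ℝ)
    (F : ℝ → Matrix (Fin N) (Fin M) ℝ)
    (I : Set ℝ) (hI : Convex ℝ I)
    (v : ℝ → Fin N → ℝ) (e : ℝ → Fin M → ℝ)
    (v' : ℝ → Fin N → ℝ) (e' : ℝ → Fin M → ℝ)
    (hv : ∀ t ∈ I, HasDerivWithinAt v (v' t) I t)
    (he : ∀ t ∈ I, HasDerivWithinAt e (e' t) I t)
    (hmom : ∀ t ∈ I, MV *ᵥ v' t = -(F t *ᵥ fun _ => (1 : ℝ)))
    (hene : ∀ t ∈ I, ME *ᵥ e' t = (F t)ᵀ *ᵥ v t) :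
    ∀ t ∈ I, ∀ s ∈ I,
      (1 / 2 : ℝ) * (v t ⬝ᵥ (MV *ᵥ v t)) + (fun _ => (1 : ℝ)) ⬝ᵥ (ME *ᵥ e t) =
        (1 / 2 : ℝ) * (v s ⬝ᵥ (MV *ᵥ v s)) + (fun _ => (1 : ℝ)) ⬝ᵥ (ME *ᵥ e s) := by
  intro t ht s hs
  have henergy : ∀ x ∈ I, HasDerivWithinAt
      (fun x => (1 / 2 : ℝ) * (v x ⬝ᵥ (MV *ᵥ v x)) + (fun _ => (1 : ℝ)) ⬝ᵥ (ME *ᵥ e x)) 0 I x := by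
    intro x hx
    have hkin := ((hv x hx).dotProduct ((hv x hx).const_mulVec MV)).const_mul (1 / 2 : ℝ)
    have hint := (hasDerivWithinAt_const x I (fun _ : Fin M => (1 : ℝ))).dotProduct
      ((he x hx).const_mulVec ME)
    have hsymm : v' x ⬝ᵥ (MV *ᵥ v x) = v x ⬝ᵥ (MV *ᵥ v' x) := by
      rw [dotProduct_mulVec, ← mulVec_transpose, hMVsymm, dotProduct_comm]
    have hwork : (fun _ => (1 : ℝ)) ⬝ᵥ ((F x)ᵀ *ᵥ v x) = v x ⬝ᵥ (F x *ᵥ fun _ => (1 : ℝ)) := by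
      rw [mulVec_transpose, dotProduct_comm, dotProduct_mulVec]
    refine (hkin.add hint).congr_deriv ?_
    rw [hsymm, hmom x hx, hene x hx, hwork, dotProduct_neg, zero_dotProduct]
    ring
  have hbound := hI.norm_image_sub_le_of_norm_hasDerivWithin_le (C := 0) henergy
    (fun _ _ => norm_zero.le) hs ht
  rw [zero_mul] at hbound
  exact sub_eq_zero.mp (norm_le_zero_iff.mp hbound)
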